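/- arXiv:1404.3905 — 2 statements merged into one kernel-verified Lean document; each statement's English description precedes it below -/
import Mathlib

section
/- Let u ∈ ℋ_d and let r = (r_1,…,r_{d−1}) be a tuple of nonnegative integers. Then there exists v ∈ M_{≤r} which is quasi-optimal with constant √(d−1): for every w ∈ M_{≤r} one has ‖u − v‖ ≤ √(d−1) · ‖u − w‖. -/
/-- The `i`-th TT-matricisation of a tensor `u ∈ ℝ^{n_1 × ⋯ × n_d}` (zero-based: rows are
indexed by the modes `j` with `j ≤ i`, columns by the remaining modes). -/
def ttMat {d : ℕ} (n : Fin d → ℕ) (u : ((j : Fin d) → Fin (n j)) → ℝ) (i : ℕ) :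
    Matrix ((j : {j : Fin d // j.val ≤ i}) → Fin (n j.val))
           ((j : {j : Fin d // ¬ j.val ≤ i}) → Fin (n j.val)) ℝ :=
  fun ρ c => u fun j => if h : j.val ≤ i then ρ ⟨j, h⟩ else c ⟨j, h⟩

/-- `u` has TT-rank at most `r = (r_1, …, r_{d-1})`. -/
noncomputable def ttRankLE {d : ℕ} (n : Fin d → ℕ) (u : ((j : Fin d) → Fin (n j)) → ℝ)
    (r : Fin (d - 1) → ℕ) : Prop :=
  ∀ i : Fin (d - 1), (ttMat n u i.val).rank ≤ r i

theorem isClosed_setOf_rank_le {L R : Type*} [Fintype L] [Fintype R] (r : ℕ) :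
    IsClosed {x : EuclideanSpace ℝ (L × R) | (Matrix.of fun l c => x (l, c)).rank ≤ r} := by
  classical
  let φ : EuclideanSpace ℝ (L × R) →ₗ[ℝ] ((R → ℝ) →L[ℝ] (L → ℝ)) :=
    { toFun := fun x => LinearMap.toContinuousLinearMap (Matrix.of fun l c => x (l, c)).mulVecLin
      map_add' := fun x y => by
        ext; simp [Matrix.mulVec, dotProduct, Finset.sum_add_distrib, add_mul]
      map_smul' := fun a x => by
        ext; simp [Matrix.mulVec, dotProduct, Finset.mul_sum, mul_assoc] }
  have hφ : Continuous φ := φ.continuous_of_finiteDimensional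
  have h := ((isOpen_setOfPred_nat_le_rank (𝕜 := ℝ) (E := R → ℝ) (F := L → ℝ)
    (r + 1)).preimage hφ).isClosed_compl
  convert h using 1
  ext x
  simp only [Set.mem_ofPred_eq, Set.mem_compl_iff, Set.mem_preimage, Matrix.rank]
  change _ ↔ ¬ (((r + 1 : ℕ) : Cardinal) ≤
    LinearMap.rank (Matrix.of fun l c => x (l, c)).mulVecLin)
  rw [LinearMap.rank, ← Module.finrank_eq_rank, Nat.cast_le]
  omega

theorem rank_eq_finrank_range_toEuclideanLin {L R : Type*} [Fintype L] [Fintype R] [DecidableEq R]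
    (B : Matrix L R ℝ) : B.rank = Module.finrank ℝ (LinearMap.range B.toEuclideanLin) := by
  rw [Matrix.toEuclideanLin, Matrix.toLpLin_eq_toLin]
  exact B.rank_eq_finrank_range_toLin _ _

/-- An orthogonal projection onto a subspace of dimension at most `r` that is at least as good a
column-space approximation of `M` as any matrix of rank at most `r`. -/
theorem exists_projection_matrix {L R : Type*} [Fintype L] [Fintype R] (M : Matrix L R ℝ) (r : ℕ) :
    ∃ A : Matrix L L ℝ, A.rank ≤ r ∧ ∀ N N' : Matrix L R ℝ, N'.rank ≤ r →
      ∑ p : L × R, ((M - A * N) p.1 p.2) ^ 2 ≤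
        ∑ p : L × R, ((M - N') p.1 p.2) ^ 2 + ∑ p : L × R, ((M - N) p.1 p.2) ^ 2 := by
  classical
  obtain ⟨x₀, hx₀, hmin⟩ := (isClosed_setOf_rank_le (L := L) (R := R) r).exists_infDist_eq_dist
    ⟨0, (Matrix.rank_zero (R := ℝ) (m := L) (n := R)).le.trans r.zero_le⟩
    (WithLp.toLp 2 fun p : L × R => M p.1 p.2)
  set N₀ : Matrix L R ℝ := Matrix.of fun l c => x₀ (l, c) with hN₀
  let col (N : Matrix L R ℝ) (c : R) : EuclideanSpace ℝ L := WithLp.toLp 2 fun l => N l c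
  let W : Submodule ℝ (EuclideanSpace ℝ L) := LinearMap.range N₀.toEuclideanLin
  let A : Matrix L L ℝ := Matrix.toEuclideanLin.symm W.starProjection.toLinearMap
  have hA : A.toEuclideanLin = W.starProjection.toLinearMap := LinearEquiv.apply_symm_apply _ _
  have hcol (N : Matrix L R ℝ) (c : R) : col (A * N) c = W.starProjection (col N c) := by
    have := LinearMap.congr_fun hA (col N c)
    rw [ContinuousLinearMap.coe_coe] at this
    rw [← this]
    rfl
  have hfro (N : Matrix L R ℝ) : ∑ p : L × R, (N p.1 p.2) ^ 2 = ∑ c, ‖col N c‖ ^ 2 := by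
    simp_rw [EuclideanSpace.real_norm_sq_eq, Fintype.sum_prod_type_right]; rfl
  have hsub (N N' : Matrix L R ℝ) (c : R) : col (N - N') c = col N c - col N' c := rfl
  have hmem (c : R) : col N₀ c ∈ W := by
    refine ⟨EuclideanSpace.single c 1, ?_⟩
    ext l
    simp [col, Matrix.toLpLin_apply]
  refine ⟨A, ?_, fun N N' hN' => ?_⟩
  · have hr : LinearMap.range W.starProjection.toLinearMap = W := W.range_starProjection
    rw [rank_eq_finrank_range_toEuclideanLin, hA, hr]
    exact (rank_eq_finrank_range_toEuclideanLin N₀).symm.le.trans hx₀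
  have hbest : ∑ p : L × R, ((M - N₀) p.1 p.2) ^ 2 ≤ ∑ p : L × R, ((M - N') p.1 p.2) ^ 2 := by
    have h := Metric.infDist_le_dist_of_mem
      (s := {x : EuclideanSpace ℝ (L × R) | (Matrix.of fun l c => x (l, c)).rank ≤ r})
      (x := WithLp.toLp 2 fun p : L × R => M p.1 p.2)
      (y := WithLp.toLp 2 fun p : L × R => N' p.1 p.2) hN'
    rw [hmin, dist_eq_norm, dist_eq_norm] at h
    have h2 := pow_le_pow_left₀ (norm_nonneg _) h 2
    rw [EuclideanSpace.real_norm_sq_eq, EuclideanSpace.real_norm_sq_eq] at h2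
    exact h2
  refine le_trans ?_ (add_le_add_left hbest _)
  simp_rw [hfro, ← Finset.sum_add_distrib, hsub, hcol]
  refine Finset.sum_le_sum fun c _ => ?_
  have h1 : ‖col M c - W.starProjection (col M c)‖ ≤ ‖col M c - col N₀ c‖ := by
    rw [Submodule.starProjection_minimal]
    exact ciInf_le ⟨0, by rintro _ ⟨y, rfl⟩; exact norm_nonneg _⟩ (⟨col N₀ c, hmem c⟩ : W)
  have h2 : ‖W.starProjection (col M c - col N c)‖ ≤ ‖col M c - col N c‖ :=
    W.norm_starProjection_apply_le _
  have hidem : W.starProjection (W.starProjection (col N c)) = W.starProjection (col N c) :=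
    W.starProjection_eq_self_iff.mpr (W.starProjection_apply_mem _)
  have h3 : Wᗮ.starProjection (col M c - W.starProjection (col N c)) =
      col M c - W.starProjection (col M c) := by
    rw [Submodule.starProjection_orthogonal_val, map_sub, hidem]
    abel
  rw [W.norm_sq_eq_add_norm_sq_starProjection, h3, map_sub, hidem, ← map_sub, add_comm]
  gcongr

/-- The tensor whose `i`-th TT-matricisation is `M`. -/
def ttUnmat {d : ℕ} (n : Fin d → ℕ) (i : ℕ)
    (M : Matrix ((j : {j : Fin d // j.val ≤ i}) → Fin (n j.val))
      ((j : {j : Fin d // ¬ j.val ≤ i}) → Fin (n j.val)) ℝ) : ((j : Fin d) → Fin (n j)) → ℝ :=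
  fun μ => M (fun j => μ j.val) (fun j => μ j.val)

theorem ttMat_ttUnmat {d : ℕ} (n : Fin d → ℕ) (i : ℕ)
    (M : Matrix ((j : {j : Fin d // j.val ≤ i}) → Fin (n j.val))
      ((j : {j : Fin d // ¬ j.val ≤ i}) → Fin (n j.val)) ℝ) :
    ttMat n (ttUnmat n i M) i = M := by
  ext ρ c
  simp only [ttMat, ttUnmat]
  congr 1 <;> funext j
  · simp [j.2]
  · rw [dif_neg j.2]

theorem norm_sub_sq_eq_sum_ttMat {d : ℕ} (n : Fin d → ℕ) (i : ℕ)
    (x y : EuclideanSpace ℝ ((j : Fin d) → Fin (n j))) :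
    ‖x - y‖ ^ 2 =
      ∑ p : ((j : {j : Fin d // j.val ≤ i}) → Fin (n j.val)) ×
        ((j : {j : Fin d // ¬ j.val ≤ i}) → Fin (n j.val)),
        ((ttMat n (fun μ => x μ) i - ttMat n (fun μ => y μ) i) p.1 p.2) ^ 2 := by
  rw [EuclideanSpace.real_norm_sq_eq]
  exact ((Equiv.piEquivPiSubtypeProd (fun j : Fin d => j.val ≤ i)
    (fun j => Fin (n j))).symm.sum_comp fun μ => ((x - y) μ) ^ 2).symm

/-- Multiplying the `j`-th matricisation from the left does not increase the rank of the `i`-th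
one when `j ≤ i`. -/
theorem rank_ttMat_ttUnmat_mul_le {d : ℕ} (n : Fin d → ℕ) {i j : ℕ} (hij : j ≤ i)
    (A : Matrix ((k : {k : Fin d // k.val ≤ j}) → Fin (n k.val))
      ((k : {k : Fin d // k.val ≤ j}) → Fin (n k.val)) ℝ)
    (x : ((k : Fin d) → Fin (n k)) → ℝ) :
    (ttMat n (ttUnmat n j (A * ttMat n x j)) i).rank ≤ (ttMat n x i).rank := by
  classical
  let merge (ρ : (k : {k : Fin d // k.val ≤ j}) → Fin (n k.val))
      (α : (k : {k : Fin d // k.val ≤ i}) → Fin (n k.val)) :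
      (k : {k : Fin d // k.val ≤ i}) → Fin (n k.val) :=
    fun k => if h : k.val.val ≤ j then ρ ⟨k.val, h⟩ else α k
  let B : Matrix ((k : {k : Fin d // k.val ≤ i}) → Fin (n k.val))
      ((k : {k : Fin d // k.val ≤ i}) → Fin (n k.val)) ℝ :=
    Matrix.of fun α α' => ∑ ρ, A (fun k => α ⟨k.val, k.2.trans hij⟩) ρ *
      if merge ρ α = α' then 1 else 0
  have h : ttMat n (ttUnmat n j (A * ttMat n x j)) i = B * ttMat n x i := by
    ext α c
    simp only [B, Matrix.mul_apply, Matrix.of_apply, Finset.sum_mul]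
    rw [Finset.sum_comm]
    simp only [mul_assoc, ite_mul, one_mul, zero_mul, mul_ite, mul_zero, Finset.sum_ite_eq,
      Finset.mem_univ, if_true]
    simp only [ttMat, ttUnmat, Matrix.mul_apply]
    refine Finset.sum_congr rfl fun ρ _ => ?_
    congr 2
    · funext k
      rw [dif_pos (k.2.trans hij)]
    · funext k
      simp only [merge]
      split_ifs <;> first | rfl | omega
  rw [h]
  exact Matrix.rank_mul_le_right _ _

/-- Truncating the last `m` matricisations, from right to left, accumulates at most `m` times the
squared error of any admissible competitor. -/
theorem exists_truncation_last {d : ℕ} (n : Fin d → ℕ)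
    (u : EuclideanSpace ℝ ((j : Fin d) → Fin (n j))) (r : Fin (d - 1) → ℕ)
    (m : ℕ) (hm : m ≤ d - 1) :
    ∃ v : EuclideanSpace ℝ ((j : Fin d) → Fin (n j)),
      (∀ i : Fin (d - 1), d - 1 ≤ i.val + m → (ttMat n (fun μ => v μ) i.val).rank ≤ r i) ∧
      ∀ w : EuclideanSpace ℝ ((j : Fin d) → Fin (n j)),
        ttRankLE n (fun μ => w μ) r → ‖u - v‖ ^ 2 ≤ m * ‖u - w‖ ^ 2 := by
  induction m with
  | zero => exact ⟨u, fun i hi => by omega, fun w _ => by simp⟩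
  | succ m ih =>
    obtain ⟨x, hxr, hxe⟩ := ih (by omega)
    let k : Fin (d - 1) := ⟨d - 1 - (m + 1), by omega⟩
    obtain ⟨A, hA, hbest⟩ := exists_projection_matrix (ttMat n (fun μ => u μ) k.val) (r k)
    obtain ⟨v, hv⟩ : ∃ v : EuclideanSpace ℝ ((j : Fin d) → Fin (n j)),
        (fun μ => v μ) = ttUnmat n k.val (A * ttMat n (fun μ => x μ) k.val) :=
      ⟨WithLp.toLp 2 _, rfl⟩
    refine ⟨v, fun i hi => ?_, fun w hw => ?_⟩
    · rw [hv]
      rcases eq_or_ne i k with rfl | hik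
      · rw [ttMat_ttUnmat]
        exact (Matrix.rank_mul_le_left _ _).trans hA
      · have hik' : i.val ≠ d - 1 - (m + 1) := fun h => hik (Fin.ext h)
        exact (rank_ttMat_ttUnmat_mul_le n (by simp only [k]; omega) A _).trans
          (hxr i (by omega))
    · have h := hbest (ttMat n (fun μ => x μ) k.val) _ (hw k)
      rw [← ttMat_ttUnmat n k.val (A * _), ← hv, ← norm_sub_sq_eq_sum_ttMat,
        ← norm_sub_sq_eq_sum_ttMat, ← norm_sub_sq_eq_sum_ttMat] at h
      have := hxe w hw
      push_cast
      linarith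

/-- quasi-optimal low TT-rank approximation.  For every tensor `u` and rank
tuple `r` there exists `v ∈ M_{≤ r}` with `‖u - v‖ ≤ √(d-1) · ‖u - w‖` for every
`w ∈ M_{≤ r}`. -/
theorem tt_quasi_optimal_approximation {d : ℕ} (hd : 2 ≤ d) (n : Fin d → ℕ)
    (hn : ∀ i, 1 ≤ n i)
    (u : EuclideanSpace ℝ ((j : Fin d) → Fin (n j))) (r : Fin (d - 1) → ℕ) :
    ∃ v : EuclideanSpace ℝ ((j : Fin d) → Fin (n j)),
      ttRankLE n (fun μ => v μ) r ∧
      ∀ w : EuclideanSpace ℝ ((j : Fin d) → Fin (n j)),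
        ttRankLE n (fun μ => w μ) r →
        ‖u - v‖ ≤ Real.sqrt ((d : ℝ) - 1) * ‖u - w‖ := by
  obtain ⟨v, hv, he⟩ := exists_truncation_last n u r (d - 1) le_rfl
  refine ⟨v, fun i => hv i (Nat.le_add_left _ _), fun w hw => ?_⟩
  have hd' : ((d - 1 : ℕ) : ℝ) = (d : ℝ) - 1 := by
    rw [Nat.cast_sub (by omega), Nat.cast_one]
  have h0 : (0 : ℝ) ≤ (d : ℝ) - 1 := hd' ▸ Nat.cast_nonneg _
  refine (sq_le_sq₀ (norm_nonneg _) (by positivity)).mp ?_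
  rw [mul_pow, Real.sq_sqrt h0, ← hd']
  exact he w hw
end

section
/- (TRIP for Gaussian maps, TT format.) There exists a universal constant C > 0 with the following property. Fix d ≥ 2, dimensions n_1,…,n_d ≥ 1, a rank tuple (r_1,…,r_{d−1}), and δ, ε ∈ (0,1), and set n = max_i n_i and r = max_i r_i. Let A_ω : ℋ_d → ℝ^m be the random linear map (A_ω u)_ℓ = Σ_μ ω(ℓ,μ) u(μ), where the entries ω(ℓ, μ_1,…,μ_d), ℓ ∈ {1,…,m}, μ_i ∈ {1,…,n_i}, are independent Gaussian random variables with mean 0 and variance 1/m (i.e., ω is drawn from the product Gaussian measure). If m ≥ C δ^{-2} max{ (d n r²) log(d r), log(1/ε) }, then with probability at least 1 − ε the following event holds: for every u ∈ M_{≤r} (TT-rank at most (r_1,…,r_{d−1})), (1−δ)‖u‖² ≤ ‖A_ω u‖² ≤ (1+δ)‖u‖². (The event in question is measurable, being closed in the entries of ω.) -/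
open MeasureTheory ProbabilityTheory

theorem card_le_of_separated_unitBall {E : Type*} [NormedAddCommGroup E] [NormedSpace ℝ E]
    [FiniteDimensional ℝ E] {η : ℝ} (hη : 0 < η) (s : Finset E) (hs : ∀ c ∈ s, ‖c‖ ≤ 1)
    (h : ∀ c ∈ s, ∀ c' ∈ s, c ≠ c' → η ≤ ‖c - c'‖) :
    (s.card : ℝ) ≤ (1 + 2 / η) ^ Module.finrank ℝ E := by
  borelize E
  let μ : Measure E := Measure.addHaar
  have hη2 : 0 < η / 2 := by positivity
  have hρ : 0 < 1 + η / 2 := by positivity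
  have hdisj : (s : Set E).PairwiseDisjoint fun c => Metric.ball c (η / 2) := by
    intro c hc c' hc' hcc
    apply Metric.ball_disjoint_ball
    rw [dist_eq_norm]
    linarith [h c hc c' hc' hcc]
  have hsub : (⋃ c ∈ s, Metric.ball c (η / 2)) ⊆ Metric.ball (0 : E) (1 + η / 2) := by
    refine Set.iUnion₂_subset fun x hx => Metric.ball_subset_ball' ?_
    rw [dist_zero_right]
    linarith [hs x hx]
  have hvol : (s.card : ENNReal) * ENNReal.ofReal ((η / 2) ^ Module.finrank ℝ E)
        * μ (Metric.ball 0 1)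
      ≤ ENNReal.ofReal ((1 + η / 2) ^ Module.finrank ℝ E) * μ (Metric.ball 0 1) := by
    have := measure_mono (μ := μ) hsub
    rw [measure_biUnion_finset hdisj fun c _ => measurableSet_ball] at this
    simpa only [μ.addHaar_ball_of_pos _ hη2, μ.addHaar_ball_of_pos _ hρ, Finset.sum_const,
      nsmul_eq_mul, mul_assoc] using this
  have hcard := (ENNReal.mul_le_mul_iff_left
    (Metric.measure_ball_pos μ (0 : E) zero_lt_one).ne' measure_ball_lt_top.ne).1 hvol
  have hreal := ENNReal.toReal_le_of_le_ofReal (by positivity) hcard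
  rw [ENNReal.toReal_mul, ENNReal.toReal_natCast, ENNReal.toReal_ofReal (by positivity)] at hreal
  have : 1 + 2 / η = (1 + η / 2) / (η / 2) := by field_simp; ring
  rw [this, div_pow, le_div_iff₀ (by positivity)]
  exact hreal

theorem exists_finset_net_unitBall (E : Type*) [NormedAddCommGroup E] [NormedSpace ℝ E]
    [FiniteDimensional ℝ E] {η : ℝ} (hη : 0 < η) :
    ∃ s : Finset E, (∀ c ∈ s, ‖c‖ ≤ 1) ∧ (∀ x : E, ‖x‖ ≤ 1 → ∃ c ∈ s, ‖x - c‖ ≤ η) ∧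
      (s.card : ℝ) ≤ (1 + 2 / η) ^ Module.finrank ℝ E := by
  classical
  let S : Set ℕ := {k | ∃ s : Finset E, (∀ c ∈ s, ‖c‖ ≤ 1) ∧
    (∀ c ∈ s, ∀ c' ∈ s, c ≠ c' → η ≤ ‖c - c'‖) ∧ s.card = k}
  have hne : S.Nonempty := ⟨0, ∅, by simp⟩
  have hbdd : BddAbove S := by
    refine ⟨⌊(1 + 2 / η) ^ Module.finrank ℝ E⌋₊, ?_⟩
    rintro _ ⟨s, hs, hsep, rfl⟩
    exact Nat.le_floor (card_le_of_separated_unitBall hη s hs hsep)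
  obtain ⟨s, hs, hsep, hmax⟩ := Nat.sSup_mem hne hbdd
  refine ⟨s, hs, fun x hx => ?_, card_le_of_separated_unitBall hη s hs hsep⟩
  by_contra! hfar
  have hxs : x ∉ s := fun hxs => by
    have := hfar x hxs
    rw [sub_self, norm_zero] at this
    linarith
  have hmem : (insert x s).card ∈ S := by
    refine ⟨insert x s, ?_, ?_, rfl⟩
    · simpa [hx] using hs
    · intro c hc c' hc' hcc
      rcases Finset.mem_insert.1 hc with rfl | h1 <;> rcases Finset.mem_insert.1 hc' with rfl | h2
      · exact absurd rfl hcc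
      · exact (hfar c' h2).le
      · rw [norm_sub_rev]; exact (hfar c h1).le
      · exact hsep c h1 c' h2 hcc
  have := le_csSup hbdd hmem
  rw [Finset.card_insert_of_notMem hxs, hmax] at this
  omega

theorem multilinear_bound_of_net {ι : Type*} [Fintype ι] {E : ι → Type*}
    [∀ i, NormedAddCommGroup (E i)] [∀ i, NormedSpace ℝ (E i)]
    (f : MultilinearMap ℝ E ℝ) {K : ℝ} (hK : ∀ x, ‖f x‖ ≤ K * ∏ i, ‖x i‖)
    (s : (i : ι) → Finset (E i)) {η : ℝ} (hη0 : 0 ≤ η) (hη : 2 * (Fintype.card ι * η) ≤ 1)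
    (hs : ∀ i, ∀ c ∈ s i, ‖c‖ ≤ 1) (hcov : ∀ i, ∀ x : E i, ‖x‖ ≤ 1 → ∃ c ∈ s i, ‖x - c‖ ≤ η)
    {M : ℝ} (hM0 : 0 ≤ M) (hM : ∀ g : (i : ι) → E i, (∀ i, g i ∈ s i) → ‖f g‖ ≤ M)
    (x : (i : ι) → E i) : ‖f x‖ ≤ 2 * M * ∏ i, ‖x i‖ := by
  let F : ContinuousMultilinearMap ℝ E ℝ := f.mkContinuous K hK
  have hunit : ∀ y : (i : ι) → E i, ‖y‖ ≤ 1 → ‖F y‖ ≤ M + ‖F‖ / 2 := by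
    intro y hy
    choose g hgs hg using fun i => hcov i (y i) ((norm_le_pi_norm y i).trans hy)
    have hg1 : ‖g‖ ≤ 1 := (pi_norm_le_iff_of_nonneg zero_le_one).2 fun i => hs i _ (hgs i)
    have hyg : ‖y - g‖ ≤ η := (pi_norm_le_iff_of_nonneg hη0).2 hg
    have h1 := F.norm_image_sub_le y g
    have h2 : max ‖y‖ ‖g‖ ^ (Fintype.card ι - 1) ≤ 1 :=
      pow_le_one₀ (le_max_of_le_left (norm_nonneg _)) (max_le hy hg1)
    have h3 : ‖F‖ * Fintype.card ι * max ‖y‖ ‖g‖ ^ (Fintype.card ι - 1) * ‖y - g‖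
        ≤ ‖F‖ * Fintype.card ι * 1 * η := by gcongr
    have h4 : ‖F g‖ ≤ M := hM g hgs
    have h5 : ‖F‖ * (Fintype.card ι * η) ≤ ‖F‖ * (1 / 2) := by
      gcongr; linarith
    have h6 : ‖F y‖ ≤ ‖F g‖ + ‖F y - F g‖ := by
      simpa using norm_add_le (F g) (F y - F g)
    nlinarith
  have hhom : ‖F‖ ≤ M + ‖F‖ / 2 := by
    refine F.opNorm_le_bound (by positivity) fun y => ?_
    by_cases h0 : ∃ i, y i = 0
    · obtain ⟨i, hi⟩ := h0
      rw [F.map_coord_zero i hi, norm_zero]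
      positivity
    · push Not at h0
      have hy : F y = (∏ i, ‖y i‖) * F fun i => ‖y i‖⁻¹ • y i := by
        rw [F.map_smul_univ, smul_eq_mul, ← mul_assoc, ← Finset.prod_mul_distrib,
          Finset.prod_eq_one fun i _ => mul_inv_cancel₀ (norm_ne_zero_iff.2 (h0 i)), one_mul]
      rw [hy, norm_mul, Real.norm_of_nonneg (Finset.prod_nonneg fun i _ => norm_nonneg _), mul_comm]
      gcongr
      refine hunit _ ((pi_norm_le_iff_of_nonneg zero_le_one).2 fun i => ?_)
      rw [norm_smul, norm_inv, norm_norm, inv_mul_cancel₀ (norm_ne_zero_iff.2 (h0 i))]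
  refine (F.le_opNorm x).trans ?_
  gcongr
  linarith

theorem integral_exp_mul_sq_gaussianReal {v : NNReal} (hv : v ≠ 0) {t : ℝ} (ht : 2 * t * v < 1) :
    ∫ x, Real.exp (t * x ^ 2) ∂(gaussianReal 0 v) = √((1 - 2 * t * v)⁻¹) := by
  have hv' : (0 : ℝ) < v := by positivity
  rw [integral_gaussianReal_eq_integral_smul hv]
  have : ∀ x : ℝ, gaussianPDFReal 0 v x • Real.exp (t * x ^ 2)
      = (√(2 * Real.pi * v))⁻¹ * Real.exp (-((1 - 2 * t * v) / (2 * v)) * x ^ 2) := by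
    intro x
    rw [gaussianPDFReal, smul_eq_mul, mul_assoc, ← Real.exp_add]
    congr 2
    field_simp
    ring
  simp_rw [this]
  rw [integral_const_mul, integral_gaussian, ← Real.sqrt_inv, ← Real.sqrt_mul (by positivity)]
  congr 1
  have : 1 - 2 * t * v ≠ 0 := by linarith
  field_simp

theorem sqrt_inv_one_sub_le_exp {x : ℝ} (hx : |x| ≤ 1 / 2) :
    √((1 - x)⁻¹) ≤ Real.exp (x / 2 + x ^ 2) := by
  have hx1 : 0 < 1 - x := by linarith [le_abs_self x]
  have h := Real.abs_log_sub_add_sum_range_le (x := x) (by linarith) 1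
  simp only [Finset.sum_range_one, zero_add, pow_one, Nat.cast_zero, div_one] at h
  have h2 : |x| ^ (1 + 1) / (1 - |x|) ≤ 2 * x ^ 2 := by
    rw [div_le_iff₀ (by linarith), show 1 + 1 = 2 from rfl, sq_abs]
    nlinarith [sq_nonneg x]
  have h3 : -(x + 2 * x ^ 2) ≤ Real.log (1 - x) := by
    have := (abs_le.1 h).1
    linarith
  rw [Real.sqrt_le_left (Real.exp_pos _).le, ← Real.exp_nat_mul]
  rw [Real.le_log_iff_exp_le hx1, Real.exp_neg] at h3
  calc (1 - x)⁻¹ ≤ (Real.exp (x + 2 * x ^ 2))⁻¹⁻¹ := by gcongr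
    _ = _ := by rw [inv_inv]; congr 1; push_cast; ring

section GaussianMatrix

variable {m : ℕ} {I : Type*} [Fintype I]

theorem iIndepFun_gaussian_rows (v : NNReal) (w : I → ℝ) :
    iIndepFun (fun (ℓ : Fin m) (ω : Fin m × I → ℝ) => ∑ μ, ω (ℓ, μ) * w μ)
      (Measure.pi fun _ : Fin m × I => gaussianReal 0 v) := by
  have hcurry : MeasurePreserving (MeasurableEquiv.curry (Fin m) I ℝ)
      (Measure.pi fun _ : Fin m × I => gaussianReal 0 v)
      (Measure.pi fun _ : Fin m => Measure.pi fun _ : I => gaussianReal 0 v) := by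
    refine ⟨by fun_prop, ?_⟩
    simpa only [Measure.infinitePi_eq_pi] using
      Measure.infinitePi_map_curry (fun (_ : Fin m) (_ : I) => gaussianReal 0 v)
  have h : iIndepFun (fun (ℓ : Fin m) (ω : Fin m → I → ℝ) => ∑ μ, ω ℓ μ * w μ)
      (Measure.pi fun _ : Fin m => Measure.pi fun _ : I => gaussianReal 0 v) :=
    iIndepFun_pi (X := fun (_ : Fin m) (x : I → ℝ) => ∑ μ, x μ * w μ)
      fun _ => Measurable.aemeasurable (by fun_prop)
  rw [iIndepFun_iff_map_fun_eq_pi_map fun _ => Measurable.aemeasurable (by fun_prop)] at h ⊢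
  rw [← hcurry.map_eq, Measure.map_map (by fun_prop) (by fun_prop)] at h
  refine h.trans ?_
  congr 1
  ext1 ℓ
  rw [Measure.map_map (by fun_prop) (by fun_prop)]
  rfl

theorem map_gaussian_row (v : NNReal) (w : I → ℝ) (ℓ : Fin m) :
    (Measure.pi fun _ : Fin m × I => gaussianReal 0 v).map (fun ω => ∑ μ, ω (ℓ, μ) * w μ)
      = gaussianReal 0 (v * (∑ μ, w μ ^ 2).toNNReal) := by
  set P := Measure.pi fun _ : Fin m × I => gaussianReal 0 v
  have hlaw : ∀ p : Fin m × I, P.map (fun ω => ω p) = gaussianReal 0 v := fun p =>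
    (measurePreserving_eval (fun _ : Fin m × I => gaussianReal 0 v) p).map_eq
  have hlaw' : ∀ μ, P.map (fun ω => ω (ℓ, μ) * w μ) =
      gaussianReal 0 (⟨w μ ^ 2, sq_nonneg _⟩ * v) := fun μ => by
    have := gaussianReal_mul_const (X := fun ω : Fin m × I → ℝ => ω (ℓ, μ)) (P := P)
      ⟨Measurable.aemeasurable (by fun_prop), hlaw (ℓ, μ)⟩ (w μ)
    rw [this.map_eq, mul_zero]
    rfl
  have hgauss : ∀ μ, HasGaussianLaw (fun ω : Fin m × I → ℝ => ω (ℓ, μ) * w μ) P := fun μ =>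
    ⟨by rw [hlaw' μ]; infer_instance⟩
  have hindep : iIndepFun (fun (μ : I) (ω : Fin m × I → ℝ) => ω (ℓ, μ) * w μ) P := by
    have := iIndepFun_pi (μ := fun _ : Fin m × I => gaussianReal 0 v)
      (X := fun (p : Fin m × I) (x : ℝ) => x * w p.2) fun _ => by fun_prop
    exact this.precomp (g := fun μ => (ℓ, μ)) (Prod.mk_right_injective ℓ)
  have hint : ∀ μ, ∫ ω, ω (ℓ, μ) * w μ ∂P = 0 := fun μ => by
    have := integral_map (μ := P) (φ := fun ω : Fin m × I → ℝ => ω (ℓ, μ) * w μ) (f := id)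
      (Measurable.aemeasurable (by fun_prop)) (by fun_prop)
    simpa [hlaw' μ] using this.symm
  have hvar : ∀ μ, Var[fun ω : Fin m × I → ℝ => ω (ℓ, μ) * w μ; P] = w μ ^ 2 * v := fun μ => by
    rw [← variance_id_map (Measurable.aemeasurable (by fun_prop)), hlaw' μ, variance_id_gaussianReal]
    rfl
  rw [(iIndepFun.hasGaussianLaw_fun_sum hgauss hindep).map_eq_gaussianReal]
  congr 1
  · rw [integral_finsetSum _ fun μ _ => (hgauss μ).integrable]
    simp [hint]
  · have : (fun ω : Fin m × I → ℝ => ∑ μ, ω (ℓ, μ) * w μ)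
        = ∑ μ, fun ω : Fin m × I → ℝ => ω (ℓ, μ) * w μ := by ext; simp
    rw [this, IndepFun.variance_sum (fun μ _ => (hgauss μ).memLp_two)
      fun i _ j _ hij => hindep.indepFun hij]
    simp_rw [hvar]
    rw [← Finset.sum_mul, Real.toNNReal_mul (Finset.sum_nonneg fun _ _ => sq_nonneg _),
      Real.toNNReal_coe, mul_comm]

theorem mgf_gaussian_energy_le (hm : 1 ≤ m) (w : I → ℝ) (hw : 0 < ∑ μ, w μ ^ 2) {y : ℝ}
    (hy : |y| ≤ 1 / 4) :
    Integrable (fun ω : Fin m × I → ℝ => Real.exp (m * y / (∑ μ, w μ ^ 2) *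
        ∑ ℓ, (∑ μ, ω (ℓ, μ) * w μ) ^ 2)) (Measure.pi fun _ => gaussianReal 0 (m : NNReal)⁻¹) ∧
    mgf (fun ω : Fin m × I → ℝ => ∑ ℓ, (∑ μ, ω (ℓ, μ) * w μ) ^ 2)
      (Measure.pi fun _ => gaussianReal 0 (m : NNReal)⁻¹) (m * y / (∑ μ, w μ ^ 2))
      ≤ Real.exp (m * (y + 4 * y ^ 2)) := by
  set P := Measure.pi fun _ : Fin m × I => gaussianReal 0 (m : NNReal)⁻¹
  set S := ∑ μ, w μ ^ 2 with hS
  set X : Fin m → (Fin m × I → ℝ) → ℝ := fun ℓ ω => (∑ μ, ω (ℓ, μ) * w μ) ^ 2 with hX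
  set t := m * y / S with ht
  have hmpos : (0 : ℝ) < m := by positivity
  have hv : (m : NNReal)⁻¹ * S.toNNReal ≠ 0 := by
    have : S.toNNReal ≠ 0 := by simpa using hw
    positivity
  have hvr : (((m : NNReal)⁻¹ * S.toNNReal : NNReal) : ℝ) = (m : ℝ)⁻¹ * S := by
    push_cast
    rw [Real.coe_toNNReal _ hw.le]
  have htv : 2 * t * ((m : NNReal)⁻¹ * S.toNNReal : NNReal) = 2 * y := by
    rw [hvr, ht]; field_simp
  have hindep : iIndepFun X P :=
    (iIndepFun_gaussian_rows _ w).comp (fun _ x => x ^ 2) fun _ => by fun_prop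
  have hmeas : ∀ ℓ, Measurable (X ℓ) := fun ℓ => by fun_prop
  have hval : ∀ ℓ, ∫ ω, Real.exp (t * X ℓ ω) ∂P = √((1 - 2 * y)⁻¹) := fun ℓ => by
    have h1 := integral_map (μ := P) (φ := fun ω : Fin m × I → ℝ => ∑ μ, ω (ℓ, μ) * w μ)
      (f := fun x => Real.exp (t * x ^ 2)) (Measurable.aemeasurable (by fun_prop)) (by fun_prop)
    rw [map_gaussian_row, integral_exp_mul_sq_gaussianReal hv
      (by rw [htv]; linarith [le_abs_self y]), htv] at h1
    exact h1.symm
  have hpos : 0 < √((1 - 2 * y)⁻¹) :=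
    Real.sqrt_pos.2 (inv_pos.2 (by linarith [le_abs_self y]))
  have hint : ∀ ℓ, Integrable (fun ω => Real.exp (t * X ℓ ω)) P := fun ℓ =>
    Integrable.of_integral_ne_zero (by rw [hval]; exact hpos.ne')
  have hsum : (fun ω : Fin m × I → ℝ => ∑ ℓ, X ℓ ω) = ∑ ℓ, X ℓ := by ext; simp
  refine ⟨?_, ?_⟩
  · have := hindep.integrable_exp_mul_sum hmeas (s := Finset.univ) (t := t) fun ℓ _ => hint ℓ
    rwa [← hsum] at this
  · rw [hsum, hindep.mgf_sum hmeas]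
    have : ∀ ℓ, mgf (X ℓ) P t = √((1 - 2 * y)⁻¹) := hval
    simp_rw [this]
    rw [Finset.prod_const, Finset.card_univ, Fintype.card_fin, Real.exp_nat_mul]
    gcongr
    refine (sqrt_inv_one_sub_le_exp (x := 2 * y) ?_).trans (le_of_eq ?_)
    · rw [abs_mul, abs_two]; linarith
    · congr 1; ring

theorem gaussian_energy_tail (hm : 1 ≤ m) (w : I → ℝ) {s : ℝ} (hs0 : 0 < s) (hs : s ≤ 1) :
    (Measure.pi fun _ : Fin m × I => gaussianReal 0 (m : NNReal)⁻¹)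
      {ω | s * ∑ μ, w μ ^ 2 < |∑ ℓ, (∑ μ, ω (ℓ, μ) * w μ) ^ 2 - ∑ μ, w μ ^ 2|}
      ≤ ENNReal.ofReal (2 * Real.exp (-(m * s ^ 2 / 16))) := by
  set P := Measure.pi fun _ : Fin m × I => gaussianReal 0 (m : NNReal)⁻¹
  rcases (Finset.sum_nonneg fun μ _ => sq_nonneg (w μ) : 0 ≤ ∑ μ, w μ ^ 2).eq_or_lt with h0 | hw
  · have hw0 : ∀ μ, w μ = 0 := by
      simpa using (Finset.sum_eq_zero_iff_of_nonneg fun μ _ => sq_nonneg (w μ)).1 h0.symm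
    simp [hw0]
  set S := ∑ μ, w μ ^ 2 with hS
  set X : (Fin m × I → ℝ) → ℝ := fun ω => ∑ ℓ, (∑ μ, ω (ℓ, μ) * w μ) ^ 2 with hX
  have hmpos : (0 : ℝ) < m := by positivity
  have hup : P.real {ω | (1 + s) * S ≤ X ω} ≤ Real.exp (-(m * s ^ 2 / 16)) := by
    obtain ⟨hi, hmgf⟩ := mgf_gaussian_energy_le hm w hw (y := s / 8)
      (by rw [abs_of_pos (by positivity)]; linarith)
    rw [← hS] at hi hmgf
    refine (measure_ge_le_exp_mul_mgf _ (by positivity) hi).trans ?_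
    refine (mul_le_mul_of_nonneg_left hmgf (Real.exp_pos _).le).trans (le_of_eq ?_)
    rw [← Real.exp_add]
    congr 1
    field_simp
    ring
  have hlow : P.real {ω | X ω ≤ (1 - s) * S} ≤ Real.exp (-(m * s ^ 2 / 16)) := by
    obtain ⟨hi, hmgf⟩ := mgf_gaussian_energy_le hm w hw (y := -(s / 8))
      (by rw [abs_neg, abs_of_pos (by positivity)]; linarith)
    rw [← hS] at hi hmgf
    refine (measure_le_le_exp_mul_mgf _ ?_ hi).trans ?_
    · rw [mul_neg, neg_div]
      exact neg_nonpos.2 (by positivity)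
    refine (mul_le_mul_of_nonneg_left hmgf (Real.exp_pos _).le).trans (le_of_eq ?_)
    rw [← Real.exp_add]
    congr 1
    field_simp
    ring
  calc P {ω | s * S < |X ω - S|}
      ≤ P ({ω | (1 + s) * S ≤ X ω} ∪ {ω | X ω ≤ (1 - s) * S}) := by
        refine measure_mono fun ω (hω : s * S < |X ω - S|) => ?_
        rcases lt_abs.1 hω with h | h
        · left; change (1 + s) * S ≤ X ω; linarith
        · right; change X ω ≤ (1 - s) * S; linarith
    _ ≤ P {ω | (1 + s) * S ≤ X ω} + P {ω | X ω ≤ (1 - s) * S} := measure_union_le _ _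
    _ ≤ ENNReal.ofReal (Real.exp (-(m * s ^ 2 / 16)))
          + ENNReal.ofReal (Real.exp (-(m * s ^ 2 / 16))) := by
        rw [← ofReal_measureReal, ← ofReal_measureReal]
        gcongr
    _ = _ := by rw [← ENNReal.ofReal_add (Real.exp_pos _).le (Real.exp_pos _).le, two_mul]

end GaussianMatrix

/-- A tensor-train core with mode size `k` and both bond dimensions `R`, viewed as its left
unfolding and carrying the operator norm. -/
abbrev TTCore (R k : ℕ) : Type :=
  EuclideanSpace ℝ (Fin R) →L[ℝ] EuclideanSpace ℝ (Fin k × Fin R)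

/-- The block of a vector indexed by `Fin k × Fin R` belonging to the first index `x`. -/
noncomputable def block {R k : ℕ} (x : Fin k) :
    EuclideanSpace ℝ (Fin k × Fin R) →ₗ[ℝ] EuclideanSpace ℝ (Fin R) where
  toFun y := WithLp.toLp 2 fun a => y (x, a)
  map_add' _ _ := rfl
  map_smul' _ _ := rfl

/-- The matrix slice of a core at the mode index `x`. -/
noncomputable def coreSlice {R k : ℕ} (x : Fin k) :
    TTCore R k →ₗ[ℝ] Module.End ℝ (EuclideanSpace ℝ (Fin R)) where
  toFun G := block x ∘ₗ G.toLinearMap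
  map_add' _ _ := by ext; simp
  map_smul' _ _ := by ext; simp

/-- The tensor train `μ ↦ e ⬝ G₁(μ₁) ⋯ G_d(μ_d) e`, where `e` is the basis vector with
index `a`, as a multilinear function of the cores. -/
noncomputable def ttMap {R d : ℕ} (n : Fin d → ℕ) (a : Fin R) :
    MultilinearMap ℝ (fun j => TTCore R (n j)) (((j : Fin d) → Fin (n j)) → ℝ) :=
  MultilinearMap.pi fun μ =>
    (((EuclideanSpace.proj a).toLinearMap ∘ₗ
      LinearMap.applyₗ (EuclideanSpace.single a (1 : ℝ))) :
        Module.End ℝ (EuclideanSpace ℝ (Fin R)) →ₗ[ℝ] ℝ).compMultilinearMap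
      ((MultilinearMap.mkPiAlgebraFin ℝ d (Module.End ℝ (EuclideanSpace ℝ (Fin R)))).compLinearMap
        fun j => coreSlice (μ j))

/-- The product of the core slices selected by a multi-index. -/
noncomputable def ttProd {R d : ℕ} {n : Fin d → ℕ} (G : (j : Fin d) → TTCore R (n j))
    (μ : (j : Fin d) → Fin (n j)) : Module.End ℝ (EuclideanSpace ℝ (Fin R)) :=
  (List.ofFn fun j => coreSlice (μ j) (G j)).prod

theorem ttMap_apply {R d : ℕ} (n : Fin d → ℕ) (a : Fin R) (G : (j : Fin d) → TTCore R (n j))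
    (μ : (j : Fin d) → Fin (n j)) :
    ttMap n a G μ = ttProd G μ (EuclideanSpace.single a 1) a := rfl

theorem ttProd_succ {R d : ℕ} {n : Fin (d + 1) → ℕ} (G : (j : Fin (d + 1)) → TTCore R (n j))
    (μ : (j : Fin (d + 1)) → Fin (n j)) :
    ttProd G μ = coreSlice (μ 0) (G 0) *
      ttProd (n := fun j => n j.succ) (fun j => G j.succ) fun j => μ j.succ := by
  rw [ttProd, List.ofFn_succ, List.prod_cons]
  rfl

theorem sum_norm_sq_block {R k : ℕ} (y : EuclideanSpace ℝ (Fin k × Fin R)) :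
    ∑ x, ‖block x y‖ ^ 2 = ‖y‖ ^ 2 := by
  simp_rw [EuclideanSpace.norm_sq_eq, Fintype.sum_prod_type]
  rfl

theorem sum_fin_succ_pi {d : ℕ} {n : Fin (d + 1) → ℕ} (f : ((j : Fin (d + 1)) → Fin (n j)) → ℝ) :
    ∑ μ, f μ = ∑ ν : ((j : Fin d) → Fin (n j.succ)), ∑ x : Fin (n 0),
      f (Fin.cons (α := fun j => Fin (n j)) x ν) := by
  rw [← (Fin.consEquiv fun j => Fin (n j)).sum_comp, Fintype.sum_prod_type, Finset.sum_comm]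
  rfl

theorem sum_norm_sq_ttProd_le {R : ℕ} : ∀ {d : ℕ} {n : Fin d → ℕ}
    (G : (j : Fin d) → TTCore R (n j)) (v : EuclideanSpace ℝ (Fin R)),
    ∑ μ, ‖ttProd G μ v‖ ^ 2 ≤ (∏ j, ‖G j‖) ^ 2 * ‖v‖ ^ 2
  | 0, n, G, v => by simp [ttProd]
  | d + 1, n, G, v => by
    rw [sum_fin_succ_pi]
    have h : ∀ ν : ((j : Fin d) → Fin (n j.succ)),
        ∑ x : Fin (n 0), ‖ttProd G (Fin.cons (α := fun j => Fin (n j)) x ν) v‖ ^ 2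
          ≤ ‖G 0‖ ^ 2 *
            ‖ttProd (n := fun j => n j.succ) (fun j => G j.succ) ν v‖ ^ 2 := fun ν => by
      simp_rw [ttProd_succ, Fin.cons_zero, Fin.cons_succ]
      rw [← mul_pow]
      refine (sum_norm_sq_block (G 0 (ttProd (n := fun j => n j.succ)
        (fun j => G j.succ) ν v))).le.trans ?_
      gcongr
      exact (G 0).le_opNorm _
    refine (Finset.sum_le_sum fun ν _ => h ν).trans ?_
    rw [← Finset.mul_sum, Fin.prod_univ_succ, mul_pow, mul_assoc]
    gcongr
    exact sum_norm_sq_ttProd_le (n := fun j => n j.succ) (fun j => G j.succ) v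

theorem sum_sq_ttMap_le {R d : ℕ} (n : Fin d → ℕ) (a : Fin R)
    (G : (j : Fin d) → TTCore R (n j)) :
    ∑ μ, ttMap n a G μ ^ 2 ≤ (∏ j, ‖G j‖) ^ 2 := by
  have h := sum_norm_sq_ttProd_le G (EuclideanSpace.single a (1 : ℝ))
  rw [PiLp.norm_single, norm_one, one_pow, mul_one] at h
  refine (Finset.sum_le_sum fun μ _ => ?_).trans h
  rw [ttMap_apply, ← sq_abs]
  gcongr
  exact PiLp.norm_apply_le (ttProd G μ (EuclideanSpace.single a 1)) a

/-- The multi-index with entries `μ j` for `j ≤ i` and `ν j` for `j > i`. -/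
def splice {d : ℕ} {n : Fin d → ℕ} (i : ℕ) (μ ν : (j : Fin d) → Fin (n j)) :
    (j : Fin d) → Fin (n j) :=
  fun j => if j.val ≤ i then μ j else ν j

theorem splice_zero_cons {d : ℕ} {n : Fin (d + 1) → ℕ} (x y : Fin (n 0))
    (μ ν : (j : Fin d) → Fin (n j.succ)) :
    splice 0 (Fin.cons (α := fun j => Fin (n j)) x μ) (Fin.cons y ν) = Fin.cons x ν := by
  funext j
  refine Fin.cases ?_ (fun j => ?_) j <;> simp [splice]

theorem splice_succ_cons {d : ℕ} {n : Fin (d + 1) → ℕ} (i : ℕ) (x y : Fin (n 0))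
    (μ ν : (j : Fin d) → Fin (n j.succ)) :
    splice (i + 1) (Fin.cons (α := fun j => Fin (n j)) x μ) (Fin.cons y ν)
      = Fin.cons x (splice (n := fun j => n j.succ) i μ ν) := by
  funext j
  refine Fin.cases ?_ (fun j => ?_) j <;> simp [splice]

/-- The first mode of a vector-valued tensor merged into its values. -/
noncomputable def gather {R d : ℕ} (n : Fin (d + 1) → ℕ) :
    (((j : Fin (d + 1)) → Fin (n j)) → EuclideanSpace ℝ (Fin R)) →ₗ[ℝ]
      (((j : Fin d) → Fin (n j.succ)) → EuclideanSpace ℝ (Fin (n 0) × Fin R)) where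
  toFun f ν := WithLp.toLp 2 fun p => f (Fin.cons p.1 ν) p.2
  map_add' _ _ := rfl
  map_smul' _ _ := rfl

theorem block_gather {R d : ℕ} {n : Fin (d + 1) → ℕ}
    (f : ((j : Fin (d + 1)) → Fin (n j)) → EuclideanSpace ℝ (Fin R)) (x : Fin (n 0))
    (ν : (j : Fin d) → Fin (n j.succ)) : block x (gather n f ν) = f (Fin.cons x ν) := rfl

theorem sum_norm_sq_gather {R d : ℕ} {n : Fin (d + 1) → ℕ}
    (f : ((j : Fin (d + 1)) → Fin (n j)) → EuclideanSpace ℝ (Fin R)) :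
    ∑ ν, ‖gather n f ν‖ ^ 2 = ∑ μ, ‖f μ‖ ^ 2 := by
  simp_rw [← sum_norm_sq_block, block_gather]
  rw [sum_fin_succ_pi]

theorem exists_contractions_of_finrank_le {R : ℕ} {X : Type*} [NormedAddCommGroup X]
    [InnerProductSpace ℝ X] (S : Submodule ℝ X) [FiniteDimensional ℝ S]
    (hS : Module.finrank ℝ S ≤ R) :
    ∃ (G : EuclideanSpace ℝ (Fin R) →L[ℝ] X) (L : X →L[ℝ] EuclideanSpace ℝ (Fin R)),
      ‖G‖ ≤ 1 ∧ ‖L‖ ≤ 1 ∧ ∀ c ∈ S, G (L c) = c := by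
  let b := stdOrthonormalBasis ℝ S
  let j₀ : S →ₗ[ℝ] EuclideanSpace ℝ (Fin R) :=
    b.toBasis.constr ℝ fun i => EuclideanSpace.single (Fin.castLE hS i) (1 : ℝ)
  have hj₀ : Orthonormal ℝ (j₀ ∘ b.toBasis) := by
    have : j₀ ∘ b.toBasis = (fun i => EuclideanSpace.single i (1 : ℝ)) ∘ Fin.castLE hS := by
      ext1 i
      simp [j₀]
    rw [this]
    exact (EuclideanSpace.orthonormal_single (𝕜 := ℝ) (ι := Fin R)).comp _ (Fin.castLE_injective hS)
  let j : S →ₗᵢ[ℝ] EuclideanSpace ℝ (Fin R) :=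
    j₀.isometryOfOrthonormal (v := b.toBasis) (by simp) hj₀
  refine ⟨S.subtypeL ∘L ContinuousLinearMap.adjoint j.toContinuousLinearMap,
    j.toContinuousLinearMap ∘L S.orthogonalProjectionOnto, ?_, ?_, fun c hc => ?_⟩
  · refine (ContinuousLinearMap.opNorm_comp_le _ _).trans (mul_le_one₀ ?_ (norm_nonneg _) ?_)
    · exact S.norm_subtypeL_le
    · rw [LinearIsometryEquiv.norm_map]
      exact j.norm_toContinuousLinearMap_le
  · exact (ContinuousLinearMap.opNorm_comp_le _ _).trans (mul_le_one₀
      j.norm_toContinuousLinearMap_le (norm_nonneg _) S.orthogonalProjectionOnto_norm_le)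
  · have h1 : S.orthogonalProjectionOnto c = ⟨c, hc⟩ :=
      S.orthogonalProjectionOnto_mem_subspace_eq_self ⟨c, hc⟩
    have h2 : ContinuousLinearMap.adjoint j.toContinuousLinearMap (j ⟨c, hc⟩) = ⟨c, hc⟩ := by
      refine ext_inner_right ℝ fun v => ?_
      rw [ContinuousLinearMap.adjoint_inner_left]
      exact j.inner_map_map _ _
    simp only [ContinuousLinearMap.comp_apply, h1]
    exact congrArg Subtype.val h2

theorem exists_ttCores {R : ℕ} (a : Fin R) : ∀ {d : ℕ} {n : Fin (d + 1) → ℕ}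
    (_ : ∀ j, 1 ≤ n j) (W : ((j : Fin (d + 1)) → Fin (n j)) → EuclideanSpace ℝ (Fin R))
    (_ : ∀ i < d, ∃ S : Submodule ℝ (((j : Fin (d + 1)) → Fin (n j)) → EuclideanSpace ℝ (Fin R)),
      Module.finrank ℝ S ≤ R ∧ ∀ ν, (fun μ => W (splice i μ ν)) ∈ S),
    ∃ G : (j : Fin (d + 1)) → TTCore R (n j),
      (∀ μ, ttProd G μ (EuclideanSpace.single a 1) = W μ) ∧
      (∏ j, ‖G j‖) ^ 2 ≤ ∑ μ, ‖W μ‖ ^ 2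
  | 0, n, hn, W, _ => by
    let c := gather n W fun j => j.elim0
    refine ⟨Fin.cons ((EuclideanSpace.proj a).smulRight c) fun j => j.elim0, fun μ => ?_, ?_⟩
    · have h : μ = Fin.cons (α := fun j => Fin (n j)) (μ 0) fun j => j.elim0 := by
        funext j
        refine Fin.cases ?_ (fun j => j.elim0) j
        simp
      rw [ttProd_succ, Fin.cons_zero]
      simp only [ttProd, List.ofFn_zero, List.prod_nil, mul_one]
      have hc : block (μ 0) c = W μ := by
        rw [block_gather]
        exact congrArg W h.symm
      rw [← hc]
      change block (μ 0) (((EuclideanSpace.proj a).smulRight c)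
        (EuclideanSpace.single a (1 : ℝ))) = _
      simp
    · rw [← sum_norm_sq_gather]
      simp only [Fin.prod_univ_succ, Fin.cons_zero, Finset.univ_eq_empty, Finset.prod_empty, mul_one]
      rw [Fintype.sum_unique, show (default : (j : Fin 0) → Fin (n j.succ)) = fun j => j.elim0 from
        Subsingleton.elim _ _]
      gcongr
      refine ContinuousLinearMap.opNorm_le_bound _ (norm_nonneg _) fun v => ?_
      rw [ContinuousLinearMap.smulRight_apply, norm_smul, mul_comm]
      gcongr
      exact PiLp.norm_apply_le _ a
  | d + 1, n, hn, W, hW => by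
    let ν₀ : (j : Fin (d + 1)) → Fin (n j.succ) := fun j => ⟨0, hn _⟩
    let x₀ : Fin (n 0) := ⟨0, hn _⟩
    obtain ⟨S, hSR, hS⟩ := hW 0 (Nat.succ_pos d)
    let T₀ := LinearMap.proj (R := ℝ) (φ := fun _ => EuclideanSpace ℝ (Fin (n 0) × Fin R)) ν₀
      ∘ₗ gather n
    obtain ⟨G₀, L, hG₀, hL, hGL⟩ := exists_contractions_of_finrank_le (S.map T₀)
      ((Submodule.finrank_map_le T₀ S).trans hSR)
    have hmem : ∀ ν, gather n W ν ∈ S.map T₀ := fun ν => by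
      refine ⟨_, hS (Fin.cons x₀ ν), ?_⟩
      ext p
      change W (splice 0 (Fin.cons p.1 ν₀) (Fin.cons x₀ ν)) p.2 = W (Fin.cons p.1 ν) p.2
      rw [splice_zero_cons]
    obtain ⟨G', hG', hprod⟩ := exists_ttCores a (n := fun j => n j.succ) (fun j => hn _)
      (fun ν => L (gather n W ν)) fun i hi => by
        obtain ⟨S', hS'R, hS'⟩ := hW (i + 1) (Nat.succ_lt_succ hi)
        let T : (((j : Fin (d + 2)) → Fin (n j)) → EuclideanSpace ℝ (Fin R)) →ₗ[ℝ]
            (((j : Fin (d + 1)) → Fin (n j.succ)) → EuclideanSpace ℝ (Fin R)) :=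
          L.toLinearMap.compLeft _ ∘ₗ gather n
        refine ⟨S'.map T, (Submodule.finrank_map_le T S').trans hS'R, fun ν => ?_⟩
        refine ⟨_, hS' (Fin.cons x₀ ν), ?_⟩
        funext μ
        change L (gather n _ μ) = L _
        congr 1
        ext p
        change W (splice (i + 1) (Fin.cons p.1 μ) (Fin.cons x₀ ν)) p.2 = W (Fin.cons p.1 _) p.2
        rw [splice_succ_cons]
    refine ⟨Fin.cons G₀ G', fun μ => ?_, ?_⟩
    · rw [ttProd_succ, Fin.cons_zero]
      simp_rw [Fin.cons_succ]
      rw [Module.End.mul_apply, hG']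
      change block (μ 0) (G₀ (L (gather n W _))) = _
      rw [hGL _ (hmem _), block_gather]
      exact congrArg W (Fin.cons_self_tail μ)
    · rw [Fin.prod_univ_succ, Fin.cons_zero, ← sum_norm_sq_gather, mul_pow]
      simp_rw [Fin.cons_succ]
      calc ‖G₀‖ ^ 2 * (∏ j, ‖G' j‖) ^ 2 ≤ 1 * (∏ j, ‖G' j‖) ^ 2 := by
            gcongr
            exact pow_le_one₀ (norm_nonneg _) hG₀
        _ ≤ ∑ ν, ‖L (gather n W ν)‖ ^ 2 := by rw [one_mul]; exact hprod
        _ ≤ _ := by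
            refine Finset.sum_le_sum fun ν _ => ?_
            gcongr
            exact (L.le_opNorm _).trans (mul_le_of_le_one_left (norm_nonneg _) hL)

theorem ttMat_splice {d : ℕ} (n : Fin d → ℕ) (u : ((j : Fin d) → Fin (n j)) → ℝ) (i : ℕ)
    (μ ν : (j : Fin d) → Fin (n j)) :
    ttMat n u i (fun j => μ j.1) (fun j => ν j.1) = u (splice i μ ν) := by
  rfl

theorem exists_ttMap_eq_of_ttRankLE {R d : ℕ} (a : Fin R) {n : Fin d → ℕ} (hd : 2 ≤ d)
    (hn : ∀ j, 1 ≤ n j) {r : Fin (d - 1) → ℕ} (hr : ∀ i, r i ≤ R)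
    {u : ((j : Fin d) → Fin (n j)) → ℝ} (hu : ttRankLE n u r) :
    ∃ G : (j : Fin d) → TTCore R (n j),
      ttMap n a G = u ∧ (∏ j, ‖G j‖) ^ 2 ≤ ∑ μ, u μ ^ 2 := by
  obtain ⟨d, rfl⟩ : ∃ k, d = k + 1 := ⟨d - 1, by omega⟩
  obtain ⟨G, hG, hprod⟩ := exists_ttCores a hn (fun μ => EuclideanSpace.single a (u μ))
    fun i hi => by
      let T : (((j : {j : Fin (d + 1) // j.val ≤ i}) → Fin (n j.val)) → ℝ) →ₗ[ℝ]
          ((j : Fin (d + 1)) → Fin (n j)) → EuclideanSpace ℝ (Fin R) :=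
        { toFun f μ := EuclideanSpace.single a (f fun j => μ j.1)
          map_add' _ _ := by ext; simp [ite_add_ite]
          map_smul' _ _ := by ext; simp }
      refine ⟨(LinearMap.range (ttMat n u i).mulVecLin).map T, ?_, fun ν => ?_⟩
      · exact (Submodule.finrank_map_le _ _).trans ((hu ⟨i, by omega⟩).trans (hr _))
      · refine ⟨_, ⟨Pi.single (fun j => ν j.1) 1, rfl⟩, ?_⟩
        funext μ
        change EuclideanSpace.single a (((ttMat n u i).mulVec _) _) = _
        rw [Matrix.mulVec_single_one, Matrix.col_apply, ttMat_splice]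
  refine ⟨G, ?_, ?_⟩
  · funext μ
    rw [ttMap_apply, hG]
    simp
  · simpa using hprod

theorem eq_zero_of_ttRankLE_zero {d : ℕ} {n : Fin d → ℕ} (hd : 2 ≤ d)
    {r : Fin (d - 1) → ℕ} (hr : ∀ i, r i = 0)
    {u : ((j : Fin d) → Fin (n j)) → ℝ} (hu : ttRankLE n u r) : u = 0 := by
  have h : (ttMat n u 0).rank = 0 := by
    have := hu ⟨0, by omega⟩
    rwa [hr, Nat.le_zero] at this
  have h0 : ttMat n u 0 = 0 := by
    rw [Matrix.rank, Submodule.finrank_eq_zero, LinearMap.range_eq_bot] at h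
    exact Matrix.mulVec_injective (funext fun v =>
      (LinearMap.congr_fun h v).trans (Matrix.zero_mulVec v).symm)
  funext μ
  have hμ := ttMat_splice n u 0 μ μ
  have hs : splice 0 μ μ = μ := funext fun j => ite_self _
  rw [h0, hs] at hμ
  exact hμ.symm

theorem finrank_ttCore (R k : ℕ) : Module.finrank ℝ (TTCore R k) = R * (k * R) := by
  rw [← (LinearMap.toContinuousLinearMap (𝕜 := ℝ) (E := EuclideanSpace ℝ (Fin R))
    (F' := EuclideanSpace ℝ (Fin k × Fin R))).finrank_eq, Module.finrank_linearMap]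
  simp

/-- The deviation of the Gram form `⟪A u, A v⟫` of a measurement map from `⟪u, v⟫`. -/
noncomputable def gramDefect {I L : Type*} [Fintype I] [Fintype L] (ω : L × I → ℝ) :
    (I → ℝ) →ₗ[ℝ] (I → ℝ) →ₗ[ℝ] ℝ :=
  LinearMap.mk₂ ℝ
    (fun u v => ∑ ℓ, (∑ μ, ω (ℓ, μ) * u μ) * (∑ μ, ω (ℓ, μ) * v μ) - ∑ μ, u μ * v μ)
    (fun u u' v => by
      simp only [Pi.add_apply, mul_add, add_mul, Finset.sum_add_distrib]
      ring)
    (fun c u v => by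
      simp only [Pi.smul_apply, smul_eq_mul, mul_left_comm _ c, ← Finset.mul_sum, mul_assoc,
        mul_sub])
    (fun u v v' => by
      simp only [Pi.add_apply, mul_add, Finset.sum_add_distrib]
      ring)
    (fun c u v => by
      simp only [Pi.smul_apply, smul_eq_mul, mul_left_comm _ c, ← Finset.mul_sum, mul_sub])

theorem gramDefect_apply {I L : Type*} [Fintype I] [Fintype L] (ω : L × I → ℝ) (u v : I → ℝ) :
    gramDefect ω u v =
      ∑ ℓ, (∑ μ, ω (ℓ, μ) * u μ) * (∑ μ, ω (ℓ, μ) * v μ) - ∑ μ, u μ * v μ := rfl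

theorem tail_gramDefect {I : Type*} [Fintype I] {m : ℕ} (hm : 1 ≤ m) {u v : I → ℝ}
    (hu : ∑ μ, u μ ^ 2 ≤ 1) (hv : ∑ μ, v μ ^ 2 ≤ 1) {s : ℝ} (hs0 : 0 < s) (hs : s ≤ 1) :
    (Measure.pi fun _ : Fin m × I => gaussianReal 0 (m : NNReal)⁻¹)
      {ω | 2 * s < |gramDefect ω u v|} ≤ ENNReal.ofReal (4 * Real.exp (-(m * s ^ 2 / 16))) := by
  have hadd : ∑ μ, (u μ + v μ) ^ 2 + ∑ μ, (u μ - v μ) ^ 2 ≤ 4 := by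
    rw [← Finset.sum_add_distrib]
    calc _ = ∑ μ, (2 * u μ ^ 2 + 2 * v μ ^ 2) := Finset.sum_congr rfl fun _ _ => by ring
      _ = 2 * ∑ μ, u μ ^ 2 + 2 * ∑ μ, v μ ^ 2 := by
        rw [Finset.sum_add_distrib, Finset.mul_sum, Finset.mul_sum]
      _ ≤ 4 := by linarith
  have hpol : ∀ ω : Fin m × I → ℝ, 4 * gramDefect ω u v =
      (∑ ℓ, (∑ μ, ω (ℓ, μ) * (u μ + v μ)) ^ 2 - ∑ μ, (u μ + v μ) ^ 2) -
        (∑ ℓ, (∑ μ, ω (ℓ, μ) * (u μ - v μ)) ^ 2 - ∑ μ, (u μ - v μ) ^ 2) := fun ω => by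
    have h1 : ∀ a b : ℝ, (a + b) ^ 2 = (a - b) ^ 2 + 4 * (a * b) := fun a b => by ring
    simp_rw [mul_add, mul_sub, Finset.sum_add_distrib, Finset.sum_sub_distrib, h1,
      Finset.sum_add_distrib, ← Finset.mul_sum, gramDefect_apply]
    ring
  refine (measure_mono fun ω hω => ?_).trans ((measure_union_le _ _).trans ((add_le_add
    (gaussian_energy_tail hm (fun μ => u μ + v μ) hs0 hs)
    (gaussian_energy_tail hm (fun μ => u μ - v μ) hs0 hs)).trans_eq ?_))
  · by_contra hnot
    simp only [Set.mem_union, Set.mem_ofPred_eq, not_or, not_lt] at hnot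
    change 2 * s < |gramDefect ω u v| at hω
    have h4 : |4 * gramDefect ω u v| ≤ s * 4 := by
      rw [hpol]
      refine (abs_sub _ _).trans ((add_le_add hnot.1 hnot.2).trans ?_)
      rw [← mul_add]
      gcongr
    rw [abs_mul, abs_of_pos (by norm_num : (0 : ℝ) < 4)] at h4
    linarith
  · rw [← ENNReal.ofReal_add (by positivity) (by positivity)]
    ring_nf

theorem exists_abs_le_of_sum_sq_le {I : Type*} [Fintype I] (f : (I → ℝ) →ₗ[ℝ] ℝ) :
    ∃ K, ∀ (v : I → ℝ) (c : ℝ), 0 ≤ c → ∑ μ, v μ ^ 2 ≤ c ^ 2 → |f v| ≤ K * c := by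
  classical
  refine ⟨√(∑ μ, f (Pi.single μ 1) ^ 2), fun v c hc hv => ?_⟩
  have hf : f v = ∑ μ, f (Pi.single μ 1) * v μ := by
    conv_lhs => rw [pi_eq_sum_univ' v, map_sum]
    simp [mul_comm]
  refine abs_le_of_sq_le_sq ?_ (by positivity)
  rw [hf, mul_pow, Real.sq_sqrt (by positivity)]
  exact (Finset.sum_mul_sq_le_sq_mul_sq _ _ _).trans (by gcongr)

theorem abs_ttMap_form_le_of_net {R d : ℕ} (n : Fin d → ℕ) (a : Fin R)
    (B : (((j : Fin d) → Fin (n j)) → ℝ) →ₗ[ℝ] (((j : Fin d) → Fin (n j)) → ℝ) →ₗ[ℝ] ℝ)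
    (s : (j : Fin d) → Finset (TTCore R (n j))) {η : ℝ} (hη0 : 0 ≤ η) (hη : 2 * (d * η) ≤ 1)
    (hs : ∀ j, ∀ c ∈ s j, ‖c‖ ≤ 1)
    (hcov : ∀ j, ∀ x : TTCore R (n j), ‖x‖ ≤ 1 → ∃ c ∈ s j, ‖x - c‖ ≤ η)
    {M : ℝ} (hM0 : 0 ≤ M) (hM : ∀ g h : (j : Fin d) → TTCore R (n j), (∀ j, g j ∈ s j) →
      (∀ j, h j ∈ s j) → |B (ttMap n a g) (ttMap n a h)| ≤ M)
    (G H : (j : Fin d) → TTCore R (n j)) :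
    |B (ttMap n a G) (ttMap n a H)| ≤ 2 * (2 * M * ∏ j, ‖G j‖) * ∏ j, ‖H j‖ := by
  have key : ∀ (f : (((j : Fin d) → Fin (n j)) → ℝ) →ₗ[ℝ] ℝ) {M : ℝ}, 0 ≤ M →
      (∀ g : (j : Fin d) → TTCore R (n j), (∀ j, g j ∈ s j) → |f (ttMap n a g)| ≤ M) →
      ∀ G : (j : Fin d) → TTCore R (n j), |f (ttMap n a G)| ≤ 2 * M * ∏ j, ‖G j‖ := by
    intro f M hM0 hM G
    obtain ⟨K, hK⟩ := exists_abs_le_of_sum_sq_le f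
    exact multilinear_bound_of_net (f.compMultilinearMap (ttMap n a))
      (fun x => hK _ _ (Finset.prod_nonneg fun _ _ => norm_nonneg _) (sum_sq_ttMap_le n a x))
      s hη0 (by simpa using hη) hs hcov hM0 hM G
  refine key (B (ttMap n a G)) (by positivity) (fun h hh => ?_) H
  exact key (B.flip (ttMap n a h)) hM0 (fun g hg => hM g h hg hh) G

theorem net_card_mul_tail_le {d N R : ℕ} (hd : 2 ≤ d) (hN : 1 ≤ N) (hR : 1 ≤ R) {m δ ε : ℝ}
    (hδ : 0 < δ) (hε : 0 < ε)
    (hm : 12288 * δ⁻¹ ^ 2 * max (((d : ℝ) * N * R ^ 2) * Real.log (d * R)) (Real.log (1 / ε)) ≤ m) :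
    (((1 + 4 * d : ℝ) ^ (R * (N * R))) ^ d) ^ 2 * (4 * Real.exp (-(m * (δ / 8) ^ 2 / 16))) ≤ ε := by
  have hd' : (2 : ℝ) ≤ d := by exact_mod_cast hd
  have hN' : (1 : ℝ) ≤ N := by exact_mod_cast hN
  have hR' : (1 : ℝ) ≤ R := by exact_mod_cast hR
  have hdR : (d : ℝ) ≤ d * R := le_mul_of_one_le_right (by positivity) hR'
  set T : ℝ := (d : ℝ) * N * R ^ 2 with hT
  have hT1 : 1 ≤ T := by
    rw [hT]
    exact one_le_mul_of_one_le_of_one_le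
      (one_le_mul_of_one_le_of_one_le (by linarith) hN') (one_le_pow₀ hR')
  set l := Real.log (d * R) with hl
  have hl2 : Real.log 2 ≤ l := Real.log_le_log (by norm_num) (by linarith)
  have hl0 : 0 < l := (Real.log_pos (by norm_num)).trans_le hl2
  have hlog : Real.log (1 + 4 * d) ≤ 4 * l := by
    have h1 : (1 + 4 * d : ℝ) ≤ (d : ℝ) ^ 4 := by
      nlinarith [mul_nonneg (sub_nonneg.2 hd') (sub_nonneg.2 hd'), sq_nonneg ((d : ℝ) ^ 2 - 4)]
    calc Real.log (1 + 4 * d) ≤ Real.log ((d : ℝ) ^ 4) := Real.log_le_log (by positivity) h1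
      _ = 4 * Real.log d := by rw [Real.log_pow]; norm_num
      _ ≤ 4 * l := by
        gcongr
        exact Real.log_le_log (by positivity) hdR
  have hlog4 : Real.log 4 ≤ 2 * (T * l) := by
    rw [show (4 : ℝ) = 2 ^ 2 by norm_num, Real.log_pow]
    push_cast
    gcongr
    exact hl2.trans (le_mul_of_one_le_left hl0.le hT1)
  have hmδ : 12 * (T * l) + -Real.log ε ≤ m * (δ / 8) ^ 2 / 16 + T * l := by
    have h1 := mul_le_mul_of_nonneg_right hm (sq_nonneg δ)
    have h2 : 12288 * δ⁻¹ ^ 2 * max (T * l) (Real.log (1 / ε)) * δ ^ 2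
        = 12288 * max (T * l) (Real.log (1 / ε)) := by
      field_simp
    rw [h2] at h1
    have h3 := le_max_left (T * l) (Real.log (1 / ε))
    have h4 := le_max_right (T * l) (Real.log (1 / ε))
    rw [one_div, Real.log_inv] at h1 h3 h4
    nlinarith
  rw [← Real.log_le_log_iff (by positivity) hε, Real.log_mul (by positivity) (by positivity),
    Real.log_mul (by positivity) (by positivity), Real.log_exp, Real.log_pow, Real.log_pow,
    Real.log_pow]
  push_cast
  have h5 : 2 * ((d : ℝ) * (R * (N * R) * Real.log (1 + 4 * d))) ≤ 8 * (T * l) := by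
    calc _ = 2 * T * Real.log (1 + 4 * d) := by rw [hT]; ring
      _ ≤ 2 * T * (4 * l) := by gcongr
      _ = _ := by ring
  have h6 : 0 < T * l := by positivity
  linarith

theorem finset_union_tail {d m R : ℕ} (hm : 1 ≤ m) (n : Fin d → ℕ) (a : Fin R)
    (t : Finset ((j : Fin d) → TTCore R (n j))) (ht : ∀ g ∈ t, ∀ j, ‖g j‖ ≤ 1)
    {s : ℝ} (hs0 : 0 < s) (hs : s ≤ 1) :
    (Measure.pi fun _ : Fin m × ((j : Fin d) → Fin (n j)) => gaussianReal 0 (m : NNReal)⁻¹)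
      (⋃ p ∈ t ×ˢ t, {ω | 2 * s < |gramDefect ω (ttMap n a p.1) (ttMap n a p.2)|}) ≤
        ENNReal.ofReal ((t.card : ℝ) ^ 2 * (4 * Real.exp (-(m * s ^ 2 / 16)))) := by
  have h1 : ∀ g ∈ t, ∑ μ, ttMap n a g μ ^ 2 ≤ 1 := fun g hg =>
    (sum_sq_ttMap_le n a g).trans (pow_le_one₀ (Finset.prod_nonneg fun _ _ => norm_nonneg _)
      (Finset.prod_le_one (fun _ _ => norm_nonneg _) fun j _ => ht g hg j))
  refine (measure_biUnion_finset_le _ _).trans ((Finset.sum_le_sum fun p hp =>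
    tail_gramDefect hm (h1 _ (Finset.mem_product.1 hp).1) (h1 _ (Finset.mem_product.1 hp).2)
      hs0 hs).trans_eq ?_)
  rw [Finset.sum_const, Finset.card_product, nsmul_eq_mul, ← ENNReal.ofReal_natCast,
    ← ENNReal.ofReal_mul (by positivity), Nat.cast_mul, ← sq]

/-- tensor restricted isometry property for Gaussian measurement maps in
the TT format.  The entries of the measurement map are i.i.d. `N(0, 1/m)` random
variables, `n = max n_i` and `r = max r_i`, and the event is that every tensor of TT-rank
at most `(r_1, …, r_{d-1})` satisfies `(1-δ)‖u‖² ≤ ‖A_ω u‖² ≤ (1+δ)‖u‖²`. -/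
theorem trip_gaussian_tt :
    ∃ C : ℝ, 0 < C ∧
      ∀ (d : ℕ) (n : Fin d → ℕ) (m : ℕ) (r : Fin (d - 1) → ℕ) (δ ε : ℝ),
        2 ≤ d → (∀ i, 1 ≤ n i) → 1 ≤ m → 0 < δ → δ < 1 → 0 < ε → ε < 1 →
        C * δ⁻¹ ^ 2 *
            max (((d : ℝ) * ((Finset.univ.sup n : ℕ) : ℝ) *
                  ((Finset.univ.sup r : ℕ) : ℝ) ^ 2) *
                    Real.log ((d : ℝ) * ((Finset.univ.sup r : ℕ) : ℝ)))
                (Real.log (1 / ε)) ≤ (m : ℝ) →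
        ENNReal.ofReal (1 - ε) ≤
          (Measure.pi fun _ : Fin m × ((j : Fin d) → Fin (n j)) =>
              gaussianReal 0 (m : NNReal)⁻¹)
            {ω | ∀ u : ((j : Fin d) → Fin (n j)) → ℝ, ttRankLE n u r →
              (1 - δ) * (∑ μ, u μ ^ 2) ≤ (∑ ℓ : Fin m, (∑ μ, ω (ℓ, μ) * u μ) ^ 2) ∧
              (∑ ℓ : Fin m, (∑ μ, ω (ℓ, μ) * u μ) ^ 2) ≤ (1 + δ) * (∑ μ, u μ ^ 2)} := by
  refine ⟨12288, by norm_num, fun d n m r δ ε hd hn hm hδ hδ1 hε hε1 hbound => ?_⟩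
  have hr : ∀ i, r i ≤ Finset.univ.sup r := fun i => Finset.le_sup (Finset.mem_univ i)
  have hnN : ∀ i, n i ≤ Finset.univ.sup n := fun i => Finset.le_sup (Finset.mem_univ i)
  generalize Finset.univ.sup r = R at hr hbound
  generalize Finset.univ.sup n = N at hnN hbound
  set P := Measure.pi fun _ : Fin m × ((j : Fin d) → Fin (n j)) =>
    gaussianReal 0 (m : NNReal)⁻¹
  rcases Nat.eq_zero_or_pos R with rfl | hR
  · have huniv : {ω : Fin m × ((j : Fin d) → Fin (n j)) → ℝ |
        ∀ u : ((j : Fin d) → Fin (n j)) → ℝ, ttRankLE n u r →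
          (1 - δ) * (∑ μ, u μ ^ 2) ≤ (∑ ℓ : Fin m, (∑ μ, ω (ℓ, μ) * u μ) ^ 2) ∧
          (∑ ℓ : Fin m, (∑ μ, ω (ℓ, μ) * u μ) ^ 2) ≤ (1 + δ) * (∑ μ, u μ ^ 2)} = Set.univ := by
      refine Set.eq_univ_of_forall fun ω u hu => ?_
      rw [eq_zero_of_ttRankLE_zero hd (fun i => Nat.le_zero.1 (hr i)) hu]
      simp
    rw [huniv, measure_univ]
    exact ENNReal.ofReal_le_one.2 (by linarith)
  have hN : 1 ≤ N := (hn ⟨0, by omega⟩).trans (hnN _)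
  have hd0 : (0 : ℝ) < d := by positivity
  let a : Fin R := ⟨0, hR⟩
  choose s hs hcov hcard using fun j => exists_finset_net_unitBall (TTCore R (n j))
    (η := 1 / (2 * d)) (by positivity)
  let t := Fintype.piFinset s
  have htcard : (t.card : ℝ) ≤ ((1 + 4 * d : ℝ) ^ (R * (N * R))) ^ d := by
    rw [Fintype.card_piFinset, Nat.cast_prod]
    refine (Finset.prod_le_prod (g := fun _ => (1 + 4 * d : ℝ) ^ (R * (N * R)))
      (fun _ _ => by positivity) fun j _ => ?_).trans_eq (by simp)
    refine (hcard j).trans ?_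
    rw [finrank_ttCore, show (1 + 2 / (1 / (2 * d)) : ℝ) = 1 + 4 * d by field_simp; ring]
    refine pow_le_pow_right₀ (by linarith) ?_
    gcongr
    exact hnN j
  let bad : Set (Fin m × ((j : Fin d) → Fin (n j)) → ℝ) :=
    ⋃ p ∈ t ×ˢ t, {ω | 2 * (δ / 8) < |gramDefect ω (ttMap n a p.1) (ttMap n a p.2)|}
  have hbad : P bad ≤ ENNReal.ofReal ε := by
    refine (finset_union_tail hm n a t
      (fun g hg j => hs j _ (Fintype.mem_piFinset.1 hg j)) (by positivity) (by linarith)).trans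
      (ENNReal.ofReal_le_ofReal (le_trans ?_ (net_card_mul_tail_le hd hN hR hδ hε hbound)))
    gcongr
  have hgood : ∀ ω, ω ∉ bad → ∀ u : ((j : Fin d) → Fin (n j)) → ℝ, ttRankLE n u r →
      (1 - δ) * (∑ μ, u μ ^ 2) ≤ (∑ ℓ : Fin m, (∑ μ, ω (ℓ, μ) * u μ) ^ 2) ∧
      (∑ ℓ : Fin m, (∑ μ, ω (ℓ, μ) * u μ) ^ 2) ≤ (1 + δ) * (∑ μ, u μ ^ 2) := by
    intro ω hω u hu
    obtain ⟨G, rfl, hG⟩ := exists_ttMap_eq_of_ttRankLE a hd hn hr hu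
    have hB := abs_ttMap_form_le_of_net n a (gramDefect ω) s (η := 1 / (2 * d)) (by positivity)
      (by field_simp; rfl) hs hcov (M := 2 * (δ / 8)) (by positivity) (fun g h hg hh => by
        by_contra hlt
        refine hω (Set.mem_biUnion (x := (g, h)) (Finset.mem_product.2
          ⟨Fintype.mem_piFinset.2 hg, Fintype.mem_piFinset.2 hh⟩) ?_)
        exact not_le.1 hlt) G G
    rw [gramDefect_apply] at hB
    simp_rw [← sq] at hB
    have hB' := abs_le.1 (hB.trans ((by ring : _ = δ * (∏ j, ‖G j‖) ^ 2).trans_le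
      (mul_le_mul_of_nonneg_left hG hδ.le)))
    constructor <;> linarith [hB'.1, hB'.2]
  rw [ENNReal.ofReal_sub _ hε.le, ENNReal.ofReal_one, tsub_le_iff_right]
  have hcompl : ∀ S, (∀ ω, ω ∉ bad → ω ∈ S) → 1 ≤ P S + ENNReal.ofReal ε := fun S hS =>
    calc (1 : ENNReal) = P Set.univ := measure_univ.symm
      _ ≤ P (S ∪ bad) := measure_mono fun ω _ => or_iff_not_imp_right.2 (hS ω)
      _ ≤ P S + P bad := measure_union_le _ _
      _ ≤ _ := by gcongr
  exact hcompl _ hgood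
end
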